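/- For every a ∈ (0,1/2] and every fixed x ∈ (0,∞), the function f(K) = η_K^a(x) is increasing, convex and log-concave on (0,∞). In particular, for all K, L, x ∈ (0,∞) and c ∈ (0,1): η_K^a(x)^c·η_L^a(x)^{1-c} ≤ η_{cK+(1-c)L}^a(x) ≤ c·η_K^a(x) + (1-c)·η_L^a(x), with equality if and only if K = L. -/

import Mathlib

open Real Set

/-- Shifted factorial (Pochhammer/Appell symbol) `(a)ₙ`. -/
noncomputable def shiftedFact (a : ℝ) : ℕ → ℝ
  | 0 => 1
  | n + 1 => shiftedFact a n * (a + n)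

/-- Gaussian hypergeometric function `F(a,b;c;x)` as a series. -/
noncomputable def hypF (a b c x : ℝ) : ℝ :=
  ∑' n : ℕ, shiftedFact a n * shiftedFact b n / (shiftedFact c n * (Nat.factorial n : ℝ)) * x ^ n

/-- Generalized complete elliptic integral of the first kind `𝒦ₐ(r)`. -/
noncomputable def ellK (a r : ℝ) : ℝ := (Real.pi / 2) * hypF a (1 - a) 1 (r ^ 2)

/-- Generalized complete elliptic integral of the second kind `ℰₐ(r)`. -/
noncomputable def ellE (a r : ℝ) : ℝ := (Real.pi / 2) * hypF (a - 1) (1 - a) 1 (r ^ 2)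

/-- The generalized Grötzsch modulus `μₐ(r)`. -/
noncomputable def muFn (a r : ℝ) : ℝ :=
  Real.pi / (2 * Real.sin (Real.pi * a)) * ellK a (Real.sqrt (1 - r ^ 2)) / ellK a r

/-- Inverse of `μₐ` (on `(0,1)`, where it is a decreasing homeomorphism onto `(0,∞)`). -/
noncomputable def muInv (a : ℝ) : ℝ → ℝ := Function.invFunOn (muFn a) (Set.Ioo 0 1)

/-- The generalized modular function `φ_K^a(r)`. -/
noncomputable def phiK (a K r : ℝ) : ℝ := muInv a (muFn a r / K)

/-- `η_K^a(x) = (s/s')²` where `s = φ_K^a(√(x/(1+x)))`. -/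
noncomputable def etaK (a K x : ℝ) : ℝ :=
  ((phiK a K (Real.sqrt (x / (1 + x)))) / Real.sqrt (1 - (phiK a K (Real.sqrt (x / (1 + x)))) ^ 2)) ^ 2

/-- `λₐ(K)`. -/
noncomputable def lambdaA (a K : ℝ) : ℝ :=
  (phiK a K (1 / Real.sqrt 2) / phiK a (1 / K) (1 / Real.sqrt 2)) ^ 2

/-- The generalized inverse hyperbolic tangent `artanh_p`. -/
noncomputable def artanhp (p x : ℝ) : ℝ := ∫ t in (0:ℝ)..x, (1 - t ^ p)⁻¹

/-- The inverse hyperbolic tangent. -/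
noncomputable def artanh (x : ℝ) : ℝ := (1 / 2) * Real.log ((1 + x) / (1 - x))

/-- Euler beta function. -/
noncomputable def betaB (x y : ℝ) : ℝ := Real.Gamma x * Real.Gamma y / Real.Gamma (x + y)

/-- `μ_{a,c}(r)`, the two-parameter generalized modulus. -/
noncomputable def muAC (a c r : ℝ) : ℝ :=
  betaB a (c - a) * hypF a (c - a) c (1 - r ^ 2) / (2 * hypF a (c - a) c (r ^ 2))

/-- Inverse of `μ_{a,c}` on `(0,1)`. -/
noncomputable def muACInv (a c : ℝ) : ℝ → ℝ := Function.invFunOn (muAC a c) (Set.Ioo 0 1)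

/-- The modular function `φ_K^{a,c}(r)`. -/
noncomputable def phiAC (a c K r : ℝ) : ℝ := muACInv a c (muAC a c r / K)

theorem ps_summable {c : ℕ → ℝ} (hc : ∀ n, |c n| ≤ 1) {y : ℝ} (hy : |y| < 1) :
    Summable fun n => c n * y ^ n := by
  refine Summable.of_norm_bounded (g := fun n => |y| ^ n)
    (summable_geometric_of_lt_one (abs_nonneg y) hy) ?_
  intro n
  rw [Real.norm_eq_abs, abs_mul, abs_pow]
  exact mul_le_of_le_one_left (by positivity) (hc n)

theorem ps_summable' {c : ℕ → ℝ} (hc : ∀ n, |c n| ≤ 1) {y : ℝ} (hy : |y| < 1) :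
    Summable fun n : ℕ => ((n : ℝ) + 1) * c (n + 1) * y ^ n := by
  have h1 : Summable fun n : ℕ => ((n : ℝ) + 1) * |y| ^ n := by
    have h2 := summable_pow_mul_geometric_of_norm_lt_one (R := ℝ) 1 (r := |y|) (by simpa using hy)
    have h3 := summable_geometric_of_lt_one (abs_nonneg y) hy
    refine (h2.add h3).congr ?_
    intro n; simp; ring
  refine Summable.of_norm_bounded h1 ?_
  intro n
  rw [Real.norm_eq_abs, abs_mul, abs_mul, abs_pow, abs_of_nonneg (by positivity : (0:ℝ) ≤ n + 1)]
  have := hc (n + 1)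
  exact mul_le_mul_of_nonneg_right (mul_le_of_le_one_right (by positivity) this) (by positivity)

theorem ps_hasDerivAt {c : ℕ → ℝ} (hc : ∀ n, |c n| ≤ 1) {y : ℝ} (hy : |y| < 1) :
    HasDerivAt (fun y : ℝ => ∑' n, c n * y ^ n) (∑' n : ℕ, ((n : ℝ) + 1) * c (n + 1) * y ^ n) y := by
  obtain ⟨r, hyr, hr⟩ := exists_between hy
  have hr0 : 0 ≤ r := (abs_nonneg y).trans hyr.le
  have hu : Summable fun n : ℕ => (n : ℝ) * r ^ (n - 1) := by
    rw [← summable_nat_add_iff 1]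
    have := ps_summable' (c := fun _ => 1) (by simp) (y := r) (by rwa [abs_of_nonneg hr0])
    simpa using this
  have key := hasDerivAt_tsum_of_isPreconnected (g := fun n (y : ℝ) => c n * y ^ n)
    (g' := fun n (y : ℝ) => c n * (n * y ^ (n - 1))) (t := Metric.ball (0:ℝ) r) (y₀ := 0) (y := y)
    hu Metric.isOpen_ball (convex_ball _ _).isPreconnected
    (fun n z _ => (hasDerivAt_pow n z).const_mul (c n))
    (fun n z hz => by
      have hz : |z| < r := by simpa using hz
      rw [Real.norm_eq_abs, abs_mul, abs_mul, abs_pow, Nat.abs_cast]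
      calc _ ≤ 1 * ((n:ℝ) * r ^ (n - 1)) := by
            gcongr
            exact hc n
        _ = _ := one_mul _)
    (by simpa using lt_of_le_of_lt (abs_nonneg y) hyr)
    (ps_summable hc (by simp)) (by simpa using hyr)
  refine key.congr_deriv ?_
  have hs : Summable fun n : ℕ => c n * ((n : ℝ) * y ^ (n - 1)) := by
    rw [← summable_nat_add_iff 1]
    refine (ps_summable' hc hy).congr ?_
    intro n; push_cast; ring
  rw [hs.tsum_eq_zero_add]
  simp only [Nat.cast_zero, zero_mul, mul_zero, zero_add]
  refine tsum_congr fun n => ?_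
  rw [Nat.add_sub_cancel]; push_cast; ring

noncomputable def cc (a : ℝ) (n : ℕ) : ℝ :=
  shiftedFact a n * shiftedFact (1 - a) n / (shiftedFact 1 n * (Nat.factorial n : ℝ))

noncomputable def hh (a : ℝ) : ℕ → ℝ
  | 0 => 0
  | n + 1 => a * (1 - a) * cc a n / (n + 1)

noncomputable def FF (a y : ℝ) : ℝ := ∑' n, cc a n * y ^ n
noncomputable def HH (a y : ℝ) : ℝ := ∑' n, hh a n * y ^ n

theorem sf_one (n : ℕ) : shiftedFact 1 n = (Nat.factorial n : ℝ) := by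
  induction n with
  | zero => simp [shiftedFact]
  | succ n ih => rw [shiftedFact, ih, Nat.factorial_succ]; push_cast; ring

theorem cc_zero (a : ℝ) : cc a 0 = 1 := by simp [cc, shiftedFact]

theorem cc_succ (a : ℝ) (n : ℕ) :
    ((n : ℝ) + 1) * cc a (n + 1) = n * cc a n + a * (1 - a) * cc a n / (n + 1) := by
  have h1 : (Nat.factorial n : ℝ) ≠ 0 := by positivity
  have h2 : (n : ℝ) + 1 ≠ 0 := by positivity
  unfold cc
  rw [sf_one, sf_one, shiftedFact, shiftedFact, Nat.factorial_succ]
  push_cast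
  field_simp
  ring

theorem aa_pos {a : ℝ} (ha : a ∈ Set.Ioc (0:ℝ) (1/2)) : 0 < a * (1 - a) := by
  obtain ⟨h1, h2⟩ := ha
  exact mul_pos h1 (by linarith)

theorem aa_le {a : ℝ} : a * (1 - a) ≤ 1 / 4 := by
  nlinarith [sq_nonneg (a - 1/2)]

theorem cc_pos {a : ℝ} (ha : a ∈ Set.Ioc (0:ℝ) (1/2)) (n : ℕ) : 0 < cc a n := by
  have h0 := aa_pos ha
  induction n with
  | zero => simp [cc_zero]
  | succ n ih =>
    have h := cc_succ a n
    have : 0 < ((n : ℝ) + 1) * cc a (n + 1) := by rw [h]; positivity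
    exact pos_of_mul_pos_right this (by positivity)

theorem cc_le {a : ℝ} (ha : a ∈ Set.Ioc (0:ℝ) (1/2)) (n : ℕ) : cc a n ≤ 1 := by
  have h1 := aa_le (a := a)
  induction n with
  | zero => simp [cc_zero]
  | succ n ih =>
    refine le_trans ?_ ih
    have h := cc_succ a n
    have hp := cc_pos ha n
    have hn : (0:ℝ) < n + 1 := by positivity
    have h2 : a * (1 - a) * cc a n / (n + 1) ≤ cc a n := by
      rw [div_le_iff₀ hn]
      nlinarith [mul_nonneg (Nat.cast_nonneg (α := ℝ) n) hp.le]
    have : ((n : ℝ) + 1) * cc a (n + 1) ≤ (n + 1) * cc a n := by linarith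
    exact le_of_mul_le_mul_left this hn

theorem cc_abs {a : ℝ} (ha : a ∈ Set.Ioc (0:ℝ) (1/2)) (n : ℕ) : |cc a n| ≤ 1 := by
  rw [abs_of_pos (cc_pos ha n)]; exact cc_le ha n

theorem hh_nonneg {a : ℝ} (ha : a ∈ Set.Ioc (0:ℝ) (1/2)) (n : ℕ) : 0 ≤ hh a n := by
  cases n with
  | zero => simp [hh]
  | succ n =>
    have := aa_pos ha
    have := cc_pos ha n
    rw [hh]; positivity

theorem hh_succ_le {a : ℝ} (ha : a ∈ Set.Ioc (0:ℝ) (1/2)) (n : ℕ) :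
    hh a (n + 1) ≤ 1 / 4 * cc a n := by
  have h1 := aa_le (a := a)
  have hp := cc_pos ha n
  rw [hh, div_le_iff₀ (by positivity)]
  nlinarith [mul_nonneg (Nat.cast_nonneg (α := ℝ) n) hp.le]

theorem hh_abs {a : ℝ} (ha : a ∈ Set.Ioc (0:ℝ) (1/2)) (n : ℕ) : |hh a n| ≤ 1 := by
  rw [abs_of_nonneg (hh_nonneg ha n)]
  cases n with
  | zero => simp [hh]
  | succ n => linarith [hh_succ_le ha n, cc_le ha n]

theorem cc_lower {a : ℝ} (ha : a ∈ Set.Ioc (0:ℝ) (1/2)) (n : ℕ) :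
    a * (1 - a) ≤ ((n : ℝ) + 1) * cc a (n + 1) := by
  induction n with
  | zero => rw [cc_succ]; simp [cc_zero]
  | succ n ih =>
    rw [cc_succ]
    have := aa_pos ha
    have := cc_pos ha (n + 1)
    have : 0 ≤ a * (1 - a) * cc a (n + 1) / (((n + 1 : ℕ) : ℝ) + 1) := by positivity
    push_cast at *
    linarith

theorem HH_deriv {a : ℝ} (ha : a ∈ Set.Ioc (0:ℝ) (1/2)) {y : ℝ} (hy : |y| < 1) :
    HasDerivAt (HH a) (a * (1 - a) * FF a y) y := by
  refine HasDerivAt.congr_deriv (f := HH a) (ps_hasDerivAt (hh_abs ha) hy) ?_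
  unfold FF
  rw [← tsum_mul_left]
  refine tsum_congr fun n => ?_
  have : (n : ℝ) + 1 ≠ 0 := by positivity
  rw [hh]; field_simp

theorem HH_eq {a : ℝ} (ha : a ∈ Set.Ioc (0:ℝ) (1/2)) {y : ℝ} (hy : |y| < 1) :
    HH a y = y * (1 - y) * ∑' n : ℕ, ((n : ℝ) + 1) * cc a (n + 1) * y ^ n := by
  have hs := ps_summable' (cc_abs ha) hy
  have hH := ps_summable (hh_abs ha) hy
  have hs2 : Summable fun n : ℕ => (n : ℝ) * cc a n * y ^ n := by
    rw [← summable_nat_add_iff 1]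
    refine (hs.mul_left y).congr ?_
    intro n; push_cast; ring
  have e2 : ∑' n : ℕ, (n : ℝ) * cc a n * y ^ n = y * ∑' n : ℕ, ((n : ℝ) + 1) * cc a (n + 1) * y ^ n := by
    rw [hs2.tsum_eq_zero_add, ← tsum_mul_left]
    simp
    exact tsum_congr fun n => by ring
  have e3 : HH a y = y * ∑' n : ℕ, (((n : ℝ) + 1) * cc a (n + 1) * y ^ n - n * cc a n * y ^ n) := by
    unfold HH
    rw [hH.tsum_eq_zero_add, ← tsum_mul_left]
    simp only [hh, zero_mul, zero_add]
    refine tsum_congr fun n => ?_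
    rw [cc_succ]; ring
  rw [e3, hs.tsum_sub hs2, e2]; ring

theorem FF_deriv {a : ℝ} (ha : a ∈ Set.Ioc (0:ℝ) (1/2)) {y : ℝ} (hy : y ∈ Set.Ioo (0:ℝ) 1) :
    HasDerivAt (FF a) (HH a y / (y * (1 - y))) y := by
  have hy' : |y| < 1 := by rw [abs_of_pos hy.1]; exact hy.2
  refine HasDerivAt.congr_deriv (f := FF a) (ps_hasDerivAt (cc_abs ha) hy') ?_
  have h1 : y ≠ 0 := hy.1.ne'
  have h2 : 1 - y ≠ 0 := by linarith [hy.2]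
  rw [HH_eq ha hy']
  field_simp

theorem FF_ge_one {a : ℝ} (ha : a ∈ Set.Ioc (0:ℝ) (1/2)) {y : ℝ} (hy : y ∈ Set.Ioo (0:ℝ) 1) :
    1 ≤ FF a y := by
  have hy' : |y| < 1 := by rw [abs_of_pos hy.1]; exact hy.2
  have := (ps_summable (cc_abs ha) hy').le_tsum 0
    (fun n _ => mul_nonneg (cc_pos ha n).le (pow_nonneg hy.1.le n))
  rw [cc_zero, pow_zero, mul_one] at this
  exact this

theorem FF_pos {a : ℝ} (ha : a ∈ Set.Ioc (0:ℝ) (1/2)) {y : ℝ} (hy : y ∈ Set.Ioo (0:ℝ) 1) :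
    0 < FF a y := lt_of_lt_of_le one_pos (FF_ge_one ha hy)

theorem HH_pos {a : ℝ} (ha : a ∈ Set.Ioc (0:ℝ) (1/2)) {y : ℝ} (hy : y ∈ Set.Ioo (0:ℝ) 1) :
    0 < HH a y := by
  have hy' : |y| < 1 := by rw [abs_of_pos hy.1]; exact hy.2
  refine (ps_summable (hh_abs ha) hy').tsum_pos
    (fun n => mul_nonneg (hh_nonneg ha n) (pow_nonneg hy.1.le n)) 1 ?_
  have := aa_pos ha
  simp [hh, cc_zero]
  exact mul_pos this hy.1

theorem HH_le {a : ℝ} (ha : a ∈ Set.Ioc (0:ℝ) (1/2)) {y : ℝ} (hy : y ∈ Set.Ioo (0:ℝ) 1) :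
    HH a y ≤ y * (1 / 4 * FF a y) := by
  have hy' : |y| < 1 := by rw [abs_of_pos hy.1]; exact hy.2
  have hH := ps_summable (hh_abs ha) hy'
  have hF := ps_summable (cc_abs ha) hy'
  unfold HH FF
  rw [hH.tsum_eq_zero_add, ← tsum_mul_left, ← tsum_mul_left]
  simp only [hh.eq_1, zero_mul, zero_add]
  refine Summable.tsum_le_tsum ?_ ((summable_nat_add_iff 1).2 hH) ((hF.mul_left _).mul_left _)
  intro n
  have := mul_le_mul_of_nonneg_right (hh_succ_le ha n) (pow_nonneg hy.1.le (n + 1))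
  refine this.trans (le_of_eq ?_)
  ring

theorem FF_log {a : ℝ} (ha : a ∈ Set.Ioc (0:ℝ) (1/2)) {y : ℝ} (hy : y ∈ Set.Ioo (0:ℝ) 1) :
    a * (1 - a) * (-Real.log (1 - y)) ≤ FF a y := by
  have hy' : |y| < 1 := by rw [abs_of_pos hy.1]; exact hy.2
  have hF := ps_summable (cc_abs ha) hy'
  have hl := (Real.hasSum_pow_div_log_of_abs_lt_one hy').mul_left (a * (1 - a))
  rw [← hl.tsum_eq]
  unfold FF
  rw [hF.tsum_eq_zero_add]
  have : ∑' n : ℕ, a * (1 - a) * (y ^ (n + 1) / (n + 1)) ≤ ∑' n : ℕ, cc a (n + 1) * y ^ (n + 1) := by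
    refine Summable.tsum_le_tsum ?_ hl.summable ((summable_nat_add_iff 1).2 hF)
    intro n
    have hn : (0:ℝ) < n + 1 := by positivity
    have h1 : a * (1 - a) / (n + 1) ≤ cc a (n + 1) := by
      rw [div_le_iff₀ hn]; linarith [cc_lower ha n]
    calc _ = a * (1 - a) / (n + 1) * y ^ (n + 1) := by ring
      _ ≤ _ := mul_le_mul_of_nonneg_right h1 (pow_nonneg hy.1.le _)
  simp only [cc_zero]
  linarith

theorem ioo_sub {y : ℝ} (hy : y ∈ Set.Ioo (0:ℝ) 1) : 1 - y ∈ Set.Ioo (0:ℝ) 1 :=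
  ⟨by linarith [hy.2], by linarith [hy.1]⟩

theorem wronsk {a : ℝ} (ha : a ∈ Set.Ioc (0:ℝ) (1/2)) :
    ∃ C : ℝ, 0 < C ∧ ∀ y ∈ Set.Ioo (0:ℝ) 1,
      HH a y * FF a (1 - y) + FF a y * HH a (1 - y) = C := by
  have hd : ∀ y ∈ Set.Ioo (0:ℝ) 1,
      HasDerivAt (fun y => HH a y * FF a (1 - y) + FF a y * HH a (1 - y)) 0 y := by
    intro y hy
    have hy2 := ioo_sub hy
    have hs : HasDerivAt (fun y : ℝ => 1 - y) (-1) y := by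
      simpa using (hasDerivAt_id y).const_sub 1
    have h1 := HH_deriv ha (y := y) (by rw [abs_of_pos hy.1]; exact hy.2)
    have h2 := FF_deriv ha hy
    have h3 := (HH_deriv ha (y := 1 - y) (by rw [abs_of_pos hy2.1]; exact hy2.2)).comp y hs
    have h4 := (FF_deriv ha hy2).comp y hs
    have := (h1.mul h4).add (h2.mul h3)
    refine HasDerivAt.congr_deriv this ?_
    have e1 : y ≠ 0 := hy.1.ne'
    have e2 : 1 - y ≠ 0 := hy2.1.ne'
    simp only [Function.comp, sub_sub_cancel]
    field_simp
    ring
  have hhalf : (1/2 : ℝ) ∈ Set.Ioo (0:ℝ) 1 := by constructor <;> norm_num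
  refine ⟨HH a (1/2) * FF a (1 - 1/2) + FF a (1/2) * HH a (1 - 1/2), ?_, ?_⟩
  · have := HH_pos ha hhalf
    have := FF_pos ha hhalf
    have := HH_pos ha (ioo_sub hhalf)
    have := FF_pos ha (ioo_sub hhalf)
    positivity
  · intro y hy
    exact isOpen_Ioo.is_const_of_deriv_eq_zero isPreconnected_Ioo
      (fun z hz => (hd z hz).differentiableAt.differentiableWithinAt)
      (fun z hz => (hd z hz).deriv) hy hhalf

noncomputable def gg (a t : ℝ) : ℝ := FF a (t / (1 + t)) / FF a (1 / (1 + t))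

theorem t_mem {t : ℝ} (ht : 0 < t) : t / (1 + t) ∈ Set.Ioo (0:ℝ) 1 :=
  ⟨by positivity, by rw [div_lt_one (by positivity)]; linarith⟩

theorem t_mem' {t : ℝ} (ht : 0 < t) : 1 / (1 + t) ∈ Set.Ioo (0:ℝ) 1 :=
  ⟨by positivity, by rw [div_lt_one (by positivity)]; linarith⟩

theorem gg_deriv {a : ℝ} (ha : a ∈ Set.Ioc (0:ℝ) (1/2)) :
    ∃ C : ℝ, 0 < C ∧ ∀ t : ℝ, 0 < t →
      HasDerivAt (gg a) (C / (t * FF a (1 / (1 + t)) ^ 2)) t := by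
  obtain ⟨C, hC, hW⟩ := wronsk ha
  refine ⟨C, hC, fun t ht => ?_⟩
  have hn : 1 + t ≠ 0 := by positivity
  have e : 1 - t / (1 + t) = 1 / (1 + t) := by field_simp; ring
  have hw := hW _ (t_mem ht)
  rw [e] at hw
  have hd : HasDerivAt (fun t : ℝ => 1 + t) 1 t := by simpa using (hasDerivAt_id t).const_add 1
  have d1 : HasDerivAt (fun t : ℝ => t / (1 + t)) (1 / (1 + t) ^ 2) t := by
    refine ((hasDerivAt_id t).div hd hn).congr_deriv ?_
    simp
  have d2 : HasDerivAt (fun t : ℝ => 1 / (1 + t)) (-1 / (1 + t) ^ 2) t := by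
    refine ((hasDerivAt_const t (1:ℝ)).div hd hn).congr_deriv ?_
    simp
  have f1 := (FF_deriv ha (t_mem ht)).comp t d1
  have f2 := (FF_deriv ha (t_mem' ht)).comp t d2
  have hF := (FF_pos ha (t_mem' ht)).ne'
  refine (f1.div f2 hF).congr_deriv ?_
  have e' : 1 - 1 / (1 + t) = t / (1 + t) := by field_simp; ring
  simp only [Function.comp, e, e']
  rw [← hw]
  have := ht.ne'
  field_simp
  ring

theorem FF_mono {a : ℝ} (ha : a ∈ Set.Ioc (0:ℝ) (1/2)) : StrictMonoOn (FF a) (Set.Ioo 0 1) := by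
  refine strictMonoOn_of_deriv_pos (convex_Ioo _ _)
    (fun y hy => (FF_deriv ha hy).continuousAt.continuousWithinAt) ?_
  rw [interior_Ioo]
  intro y hy
  rw [(FF_deriv ha hy).deriv]
  exact div_pos (HH_pos ha hy) (mul_pos hy.1 (ioo_sub hy).1)

theorem FF2_anti {a : ℝ} (ha : a ∈ Set.Ioc (0:ℝ) (1/2)) :
    AntitoneOn (fun z => (1 - z) * FF a z ^ 2) (Set.Ioo 0 1) := by
  have hd : ∀ z ∈ Set.Ioo (0:ℝ) 1, HasDerivAt (fun z => (1 - z) * FF a z ^ 2)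
      (FF a z * (2 * HH a z / z - FF a z)) z := by
    intro z hz
    have hs : HasDerivAt (fun y : ℝ => 1 - y) (-1) z := by
      simpa using (hasDerivAt_id z).const_sub 1
    refine (hs.mul ((FF_deriv ha hz).pow 2)).congr_deriv ?_
    have e1 : z ≠ 0 := hz.1.ne'
    have e2 : 1 - z ≠ 0 := (ioo_sub hz).1.ne'
    simp
    field_simp
    ring
  refine antitoneOn_of_deriv_nonpos (convex_Ioo _ _)
    (fun y hy => (hd y hy).continuousAt.continuousWithinAt) ?_ ?_ <;> rw [interior_Ioo]
  · exact fun y hy => (hd y hy).differentiableAt.differentiableWithinAt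
  · intro z hz
    rw [(hd z hz).deriv]
    have := FF_pos ha hz
    refine mul_nonpos_of_nonneg_of_nonpos this.le ?_
    have h2 := HH_le ha hz
    have : 2 * HH a z / z ≤ FF a z := by
      rw [div_le_iff₀ hz.1]
      nlinarith [mul_pos hz.1 this]
    linarith

theorem tinv_anti {s t : ℝ} (hs : 0 < s) (hst : s < t) : 1 / (1 + t) < 1 / (1 + s) :=
  one_div_lt_one_div_of_lt (by linarith) (by linarith)

theorem tF_mono {a : ℝ} (ha : a ∈ Set.Ioc (0:ℝ) (1/2)) :
    StrictMonoOn (fun t => t * FF a (1 / (1 + t)) ^ 2) (Set.Ioi 0) := by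
  intro s hs t ht hst
  rw [Set.mem_Ioi] at hs ht
  have h := FF2_anti ha (t_mem' ht) (t_mem' hs) (tinv_anti hs hst).le
  have key : ∀ t : ℝ, 0 < t → t * FF a (1 / (1 + t)) ^ 2 =
      (1 + t) * ((1 - 1 / (1 + t)) * FF a (1 / (1 + t)) ^ 2) := by
    intro t ht
    have : 1 + t ≠ 0 := by positivity
    field_simp
    ring
  have hp : 0 < (1 - 1 / (1 + t)) * FF a (1 / (1 + t)) ^ 2 :=
    mul_pos (ioo_sub (t_mem' ht)).1 (pow_pos (FF_pos ha (t_mem' ht)) 2)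
  simp only at h ⊢
  rw [key s hs, key t ht]
  nlinarith

theorem gg_smono {a : ℝ} (ha : a ∈ Set.Ioc (0:ℝ) (1/2)) : StrictMonoOn (gg a) (Set.Ioi 0) := by
  obtain ⟨C, hC, hd⟩ := gg_deriv ha
  refine strictMonoOn_of_deriv_pos (convex_Ioi _)
    (fun y hy => (hd y hy).continuousAt.continuousWithinAt) ?_
  rw [interior_Ioi]
  intro t ht
  rw [(hd t ht).deriv]
  exact div_pos hC (mul_pos ht (pow_pos (FF_pos ha (t_mem' ht)) 2))

theorem gg_concave {a : ℝ} (ha : a ∈ Set.Ioc (0:ℝ) (1/2)) :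
    StrictConcaveOn ℝ (Set.Ioi 0) (gg a) := by
  obtain ⟨C, hC, hd⟩ := gg_deriv ha
  refine StrictAntiOn.strictConcaveOn_of_deriv (convex_Ioi _)
    (fun y hy => (hd y hy).continuousAt.continuousWithinAt) ?_
  rw [interior_Ioi]
  intro s hs t ht hst
  rw [(hd t ht).deriv, (hd s hs).deriv]
  have := tF_mono ha hs ht hst
  exact div_lt_div_of_pos_left hC (mul_pos hs (pow_pos (FF_pos ha (t_mem' hs)) 2)) this

theorem gg_exp_convex {a : ℝ} (ha : a ∈ Set.Ioc (0:ℝ) (1/2)) :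
    StrictConvexOn ℝ Set.univ (fun u => gg a (Real.exp u)) := by
  obtain ⟨C, hC, hd⟩ := gg_deriv ha
  have hd' : ∀ u : ℝ, HasDerivAt (fun u => gg a (Real.exp u))
      (C / FF a (1 / (1 + Real.exp u)) ^ 2) u := by
    intro u
    refine ((hd _ (Real.exp_pos u)).comp u (Real.hasDerivAt_exp u)).congr_deriv ?_
    have := Real.exp_ne_zero u
    field_simp
  refine StrictMono.strictConvexOn_univ_of_deriv
    (continuous_iff_continuousAt.2 fun u => (hd' u).continuousAt) ?_
  intro s t hst
  rw [(hd' t).deriv, (hd' s).deriv]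
  have hF := FF_mono ha (t_mem' (Real.exp_pos t)) (t_mem' (Real.exp_pos s))
    (tinv_anti (Real.exp_pos s) (Real.exp_lt_exp.2 hst))
  have hp := FF_pos ha (t_mem' (Real.exp_pos t))
  exact div_lt_div_of_pos_left hC (pow_pos hp 2) (pow_lt_pow_left₀ hF hp.le two_ne_zero)

theorem gg_inv {a t : ℝ} (ht : 0 < t) : gg a (1 / t) = (gg a t)⁻¹ := by
  unfold gg
  rw [inv_div]
  congr 2 <;> field_simp <;> ring

theorem gg_pos {a : ℝ} (ha : a ∈ Set.Ioc (0:ℝ) (1/2)) {t : ℝ} (ht : 0 < t) : 0 < gg a t :=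
  div_pos (FF_pos ha (t_mem ht)) (FF_pos ha (t_mem' ht))

theorem gg_large {a : ℝ} (ha : a ∈ Set.Ioc (0:ℝ) (1/2)) (B : ℝ) : ∃ t : ℝ, 0 < t ∧ B ≤ gg a t := by
  have h0 := aa_pos ha
  have h12 : (1/2 : ℝ) ∈ Set.Ioo (0:ℝ) 1 := by constructor <;> norm_num
  have hp := FF_pos ha h12
  set E := |B| * FF a (1/2) / (a * (1 - a)) with hE
  have hE0 : 0 ≤ E := by positivity
  have ht : 0 < Real.exp E := Real.exp_pos E
  have ht1 : 1 ≤ Real.exp E := Real.one_le_exp hE0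
  refine ⟨Real.exp E, ht, (le_abs_self B).trans ?_⟩
  have h1 := FF_log ha (t_mem ht)
  have e : 1 - Real.exp E / (1 + Real.exp E) = (1 + Real.exp E)⁻¹ := by field_simp; ring
  rw [e, Real.log_inv, neg_neg] at h1
  have h2 : E ≤ Real.log (1 + Real.exp E) := by
    rw [Real.le_log_iff_exp_le (by positivity)]; linarith
  have h3 : |B| * FF a (1/2) ≤ FF a (Real.exp E / (1 + Real.exp E)) := by
    refine le_trans (le_of_eq ?_) ((mul_le_mul_of_nonneg_left h2 h0.le).trans h1)
    rw [hE, mul_div_cancel₀ _ h0.ne']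
  have h4 : FF a (1 / (1 + Real.exp E)) ≤ FF a (1/2) :=
    (FF_mono ha).monotoneOn (t_mem' ht) h12 (one_div_le_one_div_of_le (by norm_num) (by linarith))
  unfold gg
  rw [le_div_iff₀ (FF_pos ha (t_mem' ht))]
  exact (mul_le_mul_of_nonneg_left h4 (abs_nonneg B)).trans h3

theorem gg_surj {a : ℝ} (ha : a ∈ Set.Ioc (0:ℝ) (1/2)) {v : ℝ} (hv : 0 < v) :
    ∃ t : ℝ, 0 < t ∧ gg a t = v := by
  obtain ⟨t2, ht2, h2⟩ := gg_large ha v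
  obtain ⟨t1, ht1, h1⟩ := gg_large ha v⁻¹
  obtain ⟨C, hC, hd⟩ := gg_deriv ha
  have hc : ContinuousOn (gg a) (Set.Ioi 0) :=
    fun y hy => (hd y hy).continuousAt.continuousWithinAt
  have h1' : gg a (1 / t1) ≤ v := by
    rw [gg_inv ht1]
    exact inv_le_of_inv_le₀ hv h1
  have := isPreconnected_Ioi.intermediate_value (a := 1 / t1) (b := t2)
    (Set.mem_Ioi.2 (by positivity)) (Set.mem_Ioi.2 ht2) hc ⟨h1', h2⟩
  obtain ⟨t, ht, h⟩ := this
  exact ⟨t, ht, h⟩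

theorem muFn_eq {a : ℝ} {r : ℝ} (hr : r ∈ Set.Ioo (0:ℝ) 1) :
    muFn a r = Real.pi / (2 * Real.sin (Real.pi * a)) * (gg a (r ^ 2 / (1 - r ^ 2)))⁻¹ := by
  have h1 : 0 < 1 - r ^ 2 := by nlinarith [hr.1, hr.2]
  have e1 : r ^ 2 / (1 - r ^ 2) / (1 + r ^ 2 / (1 - r ^ 2)) = r ^ 2 := by
    have := h1.ne'
    have : 1 + r ^ 2 / (1 - r ^ 2) = 1 / (1 - r ^ 2) := by field_simp; ring
    rw [this]; field_simp
  have e2 : 1 / (1 + r ^ 2 / (1 - r ^ 2)) = 1 - r ^ 2 := by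
    have := h1.ne'
    have : 1 + r ^ 2 / (1 - r ^ 2) = 1 / (1 - r ^ 2) := by field_simp; ring
    rw [this]; field_simp
  unfold muFn ellK gg
  rw [Real.sq_sqrt h1.le, e1, e2, inv_div]
  change _ * (_ * FF a (1 - r ^ 2)) / (_ * FF a (r ^ 2)) = _
  have := Real.pi_pos.ne'
  rw [mul_div_assoc, mul_div_mul_left]
  positivity

theorem r_mem {t : ℝ} (ht : 0 < t) : Real.sqrt (t / (1 + t)) ∈ Set.Ioo (0:ℝ) 1 := by
  have := t_mem ht
  refine ⟨Real.sqrt_pos.2 this.1, ?_⟩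
  rw [Real.sqrt_lt' one_pos]; simpa using this.2

theorem muFn_sqrt {a t : ℝ} (ht : 0 < t) :
    muFn a (Real.sqrt (t / (1 + t))) =
      Real.pi / (2 * Real.sin (Real.pi * a)) * (gg a t)⁻¹ := by
  rw [muFn_eq (r_mem ht), Real.sq_sqrt (t_mem ht).1.le]
  congr 3
  have : 1 - t / (1 + t) = 1 / (1 + t) := by field_simp; ring
  rw [this]; field_simp

theorem eta_spec {a : ℝ} (ha : a ∈ Set.Ioc (0:ℝ) (1/2)) {x K : ℝ} (hx : 0 < x) (hK : 0 < K) :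
    0 < etaK a K x ∧ gg a (etaK a K x) = K * gg a x := by
  have hsin : 0 < Real.sin (Real.pi * a) := by
    apply Real.sin_pos_of_pos_of_lt_pi
    · exact mul_pos Real.pi_pos ha.1
    · nlinarith [Real.pi_pos, ha.2]
  have hc : Real.pi / (2 * Real.sin (Real.pi * a)) ≠ 0 := by
    have := Real.pi_pos
    positivity
  have hgx := gg_pos ha hx
  obtain ⟨t, ht, htv⟩ := gg_surj ha (mul_pos hK hgx)
  have hex : ∃ s ∈ Set.Ioo (0:ℝ) 1, muFn a s = muFn a (Real.sqrt (x / (1 + x))) / K := by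
    refine ⟨_, r_mem ht, ?_⟩
    rw [muFn_sqrt ht, muFn_sqrt hx, htv]
    field_simp
  have hs1 : phiK a K (Real.sqrt (x / (1 + x))) ∈ Set.Ioo (0:ℝ) 1 := Function.invFunOn_mem hex
  have hs2 : muFn a (phiK a K (Real.sqrt (x / (1 + x)))) = muFn a (Real.sqrt (x / (1 + x))) / K :=
    Function.invFunOn_eq hex
  unfold etaK
  set s := phiK a K (Real.sqrt (x / (1 + x)))
  have h1 : 0 < 1 - s ^ 2 := by nlinarith [hs1.1, hs1.2]
  rw [div_pow, Real.sq_sqrt h1.le]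
  have hpos : 0 < s ^ 2 / (1 - s ^ 2) := div_pos (pow_pos hs1.1 2) h1
  refine ⟨hpos, ?_⟩
  rw [muFn_eq hs1, muFn_sqrt hx, mul_div_assoc] at hs2
  have h3 := mul_left_cancel₀ hc hs2
  rw [← inv_inv (gg a (s ^ 2 / (1 - s ^ 2))), h3]
  field_simp

theorem eta_conv {a : ℝ} (ha : a ∈ Set.Ioc (0:ℝ) (1/2)) {x : ℝ} (hx : 0 < x) :
    StrictConvexOn ℝ (Set.Ioi 0) (fun K : ℝ => etaK a K x) := by
  refine ⟨convex_Ioi _, ?_⟩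
  intro K hK L hL hne c d hc hd hcd
  obtain ⟨pK, eK⟩ := eta_spec ha hx hK
  obtain ⟨pL, eL⟩ := eta_spec ha hx hL
  have hM : 0 < c • K + d • L := (convex_Ioi (0:ℝ)) hK hL hc.le hd.le hcd
  obtain ⟨pM, eM⟩ := eta_spec ha hx hM
  have hne' : etaK a K x ≠ etaK a L x := by
    intro h
    rw [h, eL] at eK
    exact hne (mul_right_cancel₀ (gg_pos ha hx).ne' eK.symm)
  have h := (gg_concave ha).2 pK pL hne' hc hd hcd
  have hP : 0 < c • etaK a K x + d • etaK a L x := (convex_Ioi (0:ℝ)) pK pL hc.le hd.le hcd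
  rw [← (gg_smono ha).lt_iff_lt pM hP, eM]
  refine lt_of_eq_of_lt ?_ h
  rw [eK, eL]; simp only [smul_eq_mul]; ring

theorem eta_logconc {a : ℝ} (ha : a ∈ Set.Ioc (0:ℝ) (1/2)) {x : ℝ} (hx : 0 < x) :
    StrictConcaveOn ℝ (Set.Ioi 0) (fun K : ℝ => Real.log (etaK a K x)) := by
  refine ⟨convex_Ioi _, ?_⟩
  intro K hK L hL hne c d hc hd hcd
  obtain ⟨pK, eK⟩ := eta_spec ha hx hK
  obtain ⟨pL, eL⟩ := eta_spec ha hx hL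
  have hM : 0 < c • K + d • L := (convex_Ioi (0:ℝ)) hK hL hc.le hd.le hcd
  obtain ⟨pM, eM⟩ := eta_spec ha hx hM
  have hne' : Real.log (etaK a K x) ≠ Real.log (etaK a L x) := by
    intro h
    have h := Real.log_injOn_pos pK pL h
    rw [h, eL] at eK
    exact hne (mul_right_cancel₀ (gg_pos ha hx).ne' eK.symm)
  have h := (gg_exp_convex ha).2 (Set.mem_univ _) (Set.mem_univ _) hne' hc hd hcd
  simp only [Real.exp_log pK, Real.exp_log pL] at h
  simp only
  rw [Real.lt_log_iff_exp_lt pM, ← (gg_smono ha).lt_iff_lt (Real.exp_pos _) pM, eM]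
  refine lt_of_lt_of_eq h ?_
  rw [eK, eL]; simp only [smul_eq_mul]; ring

theorem stmt12 (a : ℝ) (ha : a ∈ Set.Ioc (0:ℝ) (1/2)) (x : ℝ) (hx : 0 < x) :
    (MonotoneOn (fun K : ℝ => etaK a K x) (Set.Ioi 0) ∧
      ConvexOn ℝ (Set.Ioi 0) (fun K : ℝ => etaK a K x) ∧
      ConcaveOn ℝ (Set.Ioi 0) (fun K : ℝ => Real.log (etaK a K x))) ∧
    ∀ K L : ℝ, 0 < K → 0 < L → ∀ c : ℝ, c ∈ Set.Ioo (0:ℝ) 1 →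
      ((etaK a K x) ^ c * (etaK a L x) ^ (1 - c) ≤ etaK a (c * K + (1 - c) * L) x ∧
        etaK a (c * K + (1 - c) * L) x ≤ c * etaK a K x + (1 - c) * etaK a L x) ∧
      ((etaK a K x) ^ c * (etaK a L x) ^ (1 - c) = etaK a (c * K + (1 - c) * L) x ↔
        K = L) ∧
      (etaK a (c * K + (1 - c) * L) x = c * etaK a K x + (1 - c) * etaK a L x ↔
        K = L) := by
  refine ⟨⟨?_, (eta_conv ha hx).convexOn, (eta_logconc ha hx).concaveOn⟩, ?_⟩
  · intro K hK L hL hKL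
    obtain ⟨pK, eK⟩ := eta_spec ha hx hK
    obtain ⟨pL, eL⟩ := eta_spec ha hx hL
    simp only
    rw [← (gg_smono ha).le_iff_le pK pL, eK, eL]
    exact mul_le_mul_of_nonneg_right hKL (gg_pos ha hx).le
  · intro K L hK hL c hc
    have hc' : 0 < 1 - c := by linarith [hc.2]
    obtain ⟨pK, eK⟩ := eta_spec ha hx hK
    obtain ⟨pL, eL⟩ := eta_spec ha hx hL
    by_cases hne : K = L
    · subst hne
      have e1 : c * K + (1 - c) * K = K := by ring
      have e2 : etaK a K x ^ c * etaK a K x ^ (1 - c) = etaK a K x := by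
        rw [← Real.rpow_add pK]; simp
      rw [e1, e2]
      have e3 : c * etaK a K x + (1 - c) * etaK a K x = etaK a K x := by ring
      rw [e3]
      simp
    · have h1 := (eta_conv ha hx).2 hK hL hne hc.1 hc' (by ring)
      have h2 := (eta_logconc ha hx).2 hK hL hne hc.1 hc' (by ring)
      simp only [smul_eq_mul] at h1 h2
      have hM : 0 < c * K + (1 - c) * L := add_pos (mul_pos hc.1 hK) (mul_pos hc' hL)
      obtain ⟨pM, eM⟩ := eta_spec ha hx hM
      have h3 : etaK a K x ^ c * etaK a L x ^ (1 - c) < etaK a (c * K + (1 - c) * L) x := by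
        rw [Real.lt_log_iff_exp_lt pM] at h2
        rw [Real.rpow_def_of_pos pK, Real.rpow_def_of_pos pL, ← Real.exp_add]
        rwa [mul_comm (Real.log _) c, mul_comm (Real.log _) (1 - c)]
      exact ⟨⟨h3.le, h1.le⟩, ⟨fun h => absurd h h3.ne, fun h => absurd h hne⟩,
        ⟨fun h => absurd h h1.ne, fun h => absurd h hne⟩⟩
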